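/- arXiv:1711.00745 — 3 statements merged into one kernel-verified Lean document; each statement's English description precedes it below -/
import Mathlib

section
/- Let real constants γ̄ ≥ 0, ā ≥ 0, D ≥ 0 and x̄ satisfy x̄ ≥ γ̄ + ā + D. Let a, d, x, γ : ℕ → ℝ be sequences such that γ(0) = 0, 0 ≤ a(t) ≤ ā and d(t) ≤ D for all t, x(t) = x̄ whenever γ(t) > γ̄ and x(t) = 0 whenever γ(t) ≤ γ̄, and γ(t+1) = max(γ(t) + a(t) − x(t) + d(t), 0) for all t. Then γ(t) ≤ γ̄ + ā + D for all t ∈ ℕ. -/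
/-- Key invariant of Proposition 1 (Energy Causality): the queue multiplier
`γ` updated by the stochastic dual subgradient rule with the auxiliary
thresholding variable `x` stays bounded by `γ̄ + ā + D`. -/
theorem stmt_0 (γbar abar D xbar : ℝ)
    (hγbar : 0 ≤ γbar) (habar : 0 ≤ abar) (hD : 0 ≤ D)
    (hxbar : xbar ≥ γbar + abar + D)
    (a d x γ : ℕ → ℝ)
    (hγ0 : γ 0 = 0)
    (ha : ∀ t, 0 ≤ a t ∧ a t ≤ abar)
    (hd : ∀ t, d t ≤ D)
    (hx : ∀ t, (γ t > γbar → x t = xbar) ∧ (γ t ≤ γbar → x t = 0))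
    (hrec : ∀ t, γ (t + 1) = max (γ t + a t - x t + d t) 0) :
    ∀ t, γ t ≤ γbar + abar + D := by
  intro t
  induction t with
  | zero => linarith
  | succ t ih =>
    rw [hrec t]
    apply max_le _ (by linarith)
    have hat := (ha t).2
    have hdt := hd t
    rcases lt_or_ge γbar (γ t) with h | h
    · rw [(hx t).1 h]
      linarith
    · rw [(hx t).2 h]
      linarith
end

section
/- Let real constants w, γ̄ ≥ 0, ā ≥ 0, D ≥ 0, x̄ with x̄ ≥ γ̄ + ā + D, and battery capacity b_max with b_max ≥ w + γ̄ + ā + D be given. Let γ : ℕ → ℝ satisfy γ(0) = 0, γ(t+1) = max(γ(t) + a(t) − x(t) + d(t), 0) with 0 ≤ a(t) ≤ ā, d(t) ≤ D, and x(t) = x̄ if γ(t) > γ̄, x(t) = 0 otherwise. Let γ' : ℕ → ℝ be any sequence with γ'(t) ≥ 0, let ν : ℕ → ℝ satisfy ν(t) ≥ 0, and let the battery multiplier β : ℕ → ℝ and battery state b : ℕ → ℝ satisfy b(t) = b_max − β(t). Define the SSBP-EH routing variable r(t) = (1/2)·max(w + γ(t) − γ'(t) − β(t) − ν(t), 0).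 Then for every t with b(t) = 0, one has r(t) = 0; i.e., no transmission occurs when the battery is empty. -/
/-- A queue multiplier with auxiliary thresholding never exceeds the threshold by more than
one slot's worth of arrivals. -/
theorem queue_multiplier_le {γbar abar D xbar : ℝ}
    (hγbar : 0 ≤ γbar) (habar : 0 ≤ abar) (hD : 0 ≤ D)
    (hxbar : γbar + abar + D ≤ xbar) {a d x γ : ℕ → ℝ}
    (hγ0 : γ 0 = 0)
    (hrec : ∀ t, γ (t + 1) = max (γ t + a t - x t + d t) 0)
    (ha : ∀ t, a t ≤ abar) (hd : ∀ t, d t ≤ D)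
    (hx : ∀ t, (γ t > γbar → x t = xbar) ∧ (γ t ≤ γbar → x t = 0)) (t : ℕ) :
    γ t ≤ γbar + abar + D := by
  induction t with
  | zero => rw [hγ0]; positivity
  | succ t ih =>
    rw [hrec]
    refine max_le ?_ (by positivity)
    have hat := ha t
    have hdt := hd t
    rcases lt_or_ge γbar (γ t) with h | h
    · rw [(hx t).1 h]; linarith
    · rw [(hx t).2 h]; linarith

/-- Proposition 1 (Energy Causality), single-link form for the SSBP-EH policy:
if the battery is empty (`b t = 0`), the SSBP-EH routing decision is zero. -/
theorem stmt_1 (w γbar abar D xbar bmax : ℝ)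
    (hγbar : 0 ≤ γbar) (habar : 0 ≤ abar) (hD : 0 ≤ D)
    (hxbar : xbar ≥ γbar + abar + D)
    (hbmax : bmax ≥ w + γbar + abar + D)
    (a d x γ γ' ν β b r : ℕ → ℝ)
    (hγ0 : γ 0 = 0)
    (hrec : ∀ t, γ (t + 1) = max (γ t + a t - x t + d t) 0)
    (ha : ∀ t, 0 ≤ a t ∧ a t ≤ abar)
    (hd : ∀ t, d t ≤ D)
    (hx : ∀ t, (γ t > γbar → x t = xbar) ∧ (γ t ≤ γbar → x t = 0))
    (hγ' : ∀ t, 0 ≤ γ' t)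
    (hν : ∀ t, 0 ≤ ν t)
    (hbat : ∀ t, b t = bmax - β t)
    (hr : ∀ t, r t = (1 / 2) * max (w + γ t - γ' t - β t - ν t) 0) :
    ∀ t, b t = 0 → r t = 0 := by
  intro t hb
  have hγt := queue_multiplier_le hγbar habar hD hxbar hγ0 hrec (fun t => (ha t).2) hd hx t
  have hγ't := hγ' t
  have hνt := hν t
  have hbt := hbat t
  rw [hr, max_eq_right (by linarith), mul_zero]
end

section
/- Let b_max > 0 and let r, e, b, β : ℕ → ℝ be sequences satisfying: 0 ≤ b(0) ≤ b_max, β(0) = b_max − b(0), and for all t: 0 ≤ r(t) ≤ b(t), e(t) ≥ 0, b(t+1) = min(max(b(t) − r(t) + e(t), 0), b_max), and β(t+1) = max(β(t) + r(t) − e(t), 0). Then b(t) = b_max − β(t) for all t ∈ ℕ. -/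
/-- Battery–multiplier coupling: the battery state `b` (projected evolution on
`[0, bmax]`) and the battery dual variable `β` (nonnegative projection) remain
coupled as `b t = bmax - β t` for all time. -/
theorem stmt_2 (bmax : ℝ) (hbmax : 0 < bmax)
    (r e b β : ℕ → ℝ)
    (hb0 : 0 ≤ b 0 ∧ b 0 ≤ bmax)
    (hβ0 : β 0 = bmax - b 0)
    (hr : ∀ t, 0 ≤ r t ∧ r t ≤ b t)
    (he : ∀ t, 0 ≤ e t)
    (hbrec : ∀ t, b (t + 1) = min (max (b t - r t + e t) 0) bmax)
    (hβrec : ∀ t, β (t + 1) = max (β t + r t - e t) 0) :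
    ∀ t, b t = bmax - β t := by
  intro t
  induction t with
  | zero => linarith
  | succ t ih =>
    have h_nonneg : 0 ≤ b t - r t + e t := by linarith [(hr t).2, he t]
    have h_dual : β t + r t - e t = bmax - (b t - r t + e t) := by linarith
    rw [hbrec, hβrec, max_eq_left h_nonneg, h_dual, ← sub_self bmax, max_sub_sub_left,
      sub_sub_cancel]
end
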